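/- arXiv:2110.06333 — 5 statements merged into one kernel-verified Lean document; each statement's English description precedes it below -/
import Mathlib

section
/- For every test function φ : ℚ_p → ℝ, the function (x, y) ↦ ((φ(x) − φ(y))/|x − y|_p)² is integrable on ℚ_p × ℚ_p with respect to μ × μ (with the convention that the integrand is 0 when x = y), for each x the function y ↦ (φ(x) − φ(y))/|x − y|_p² is integrable, and ∫_{ℚ_p} ∫_{ℚ_p} ((φ(x) − φ(y))/|x − y|_p)² dμ(y) dμ(x) = 2 ∫_{ℚ_p} φ(x) ( ∫_{ℚ_p} (φ(x) − φ(y))/|x − y|_p² dμ(y) ) dμ(x). -/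
open MeasureTheory

/-- A (Bruhat–Schwartz) test function on `ℚ_[p]`: locally constant with compact support. -/
def IsTestFunction {p : ℕ} [Fact p.Prime] (φ : ℚ_[p] → ℝ) : Prop :=
  (∀ x : ℚ_[p], ∃ l : ℤ, ∀ x' : ℚ_[p], ‖x'‖ ≤ (p : ℝ) ^ (-l) → φ (x + x') = φ x) ∧
  HasCompactSupport φ

theorem IsTestFunction.isLocallyConstant {p : ℕ} [Fact p.Prime] {φ : ℚ_[p] → ℝ}
    (hφ : IsTestFunction φ) : IsLocallyConstant φ := by
  refine (IsLocallyConstant.iff_eventually_eq φ).2 fun x => ?_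
  obtain ⟨l, hl⟩ := hφ.1 x
  have hp : (0 : ℝ) < p := mod_cast (Fact.out : p.Prime).pos
  filter_upwards [Metric.closedBall_mem_nhds x (zpow_pos hp (-l))] with y hy
  rw [← hl (y - x) (by simpa [dist_eq_norm] using hy), add_sub_cancel]

/-- Test functions are uniformly locally constant. -/
theorem IsTestFunction.exists_eq_of_norm_sub_lt {p : ℕ} [Fact p.Prime] {φ : ℚ_[p] → ℝ}
    (hφ : IsTestFunction φ) : ∃ δ > 0, ∀ x y, ‖x - y‖ < δ → φ x = φ y := by
  obtain ⟨δ, hδ, h⟩ := lebesgue_number_lemma_of_metric (c := fun c : ℝ => φ ⁻¹' {c}) hφ.2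
    (fun c => hφ.isLocallyConstant.isOpen_fiber c) (fun x _ => Set.mem_iUnion.2 ⟨φ x, rfl⟩)
  have key : ∀ x y, x ∈ tsupport φ → ‖x - y‖ < δ → φ x = φ y := by
    intro x y hx hxy
    obtain ⟨c, hc⟩ := h x hx
    have h1 : φ x = c := hc (Metric.mem_ball_self hδ)
    have h2 : φ y = c := hc (by rwa [Metric.mem_ball, dist_comm, dist_eq_norm])
    rw [h1, h2]
  refine ⟨δ, hδ, fun x y hxy => ?_⟩
  by_cases hx : x ∈ tsupport φ
  · exact key x y hx hxy
  by_cases hy : y ∈ tsupport φ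
  · exact (key y x hy (by rwa [norm_sub_rev])).symm
  · rw [image_eq_zero_of_notMem_tsupport hx, image_eq_zero_of_notMem_tsupport hy]

section Padic

variable {p : ℕ} [Fact p.Prime] [MeasurableSpace ℚ_[p]] [BorelSpace ℚ_[p]]
  (μ : Measure ℚ_[p]) [μ.IsAddHaarMeasure]

theorem Padic.measure_closedBall_zpow_add_one_le (n : ℤ) :
    μ (Metric.closedBall 0 ((p : ℝ) ^ (n + 1))) ≤ p * μ (Metric.closedBall 0 ((p : ℝ) ^ n)) := by
  have hp : (0 : ℝ) < p := mod_cast (Fact.out : p.Prime).pos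
  have hp' : (p : ℚ_[p]) ≠ 0 := mod_cast (Fact.out : p.Prime).ne_zero
  have hsub : Metric.closedBall (0 : ℚ_[p]) ((p : ℝ) ^ (n + 1)) ⊆
      ⋃ d ∈ Finset.range p, Metric.closedBall ((d : ℚ_[p]) * (p : ℚ_[p]) ^ (-(n + 1)))
        ((p : ℝ) ^ n) := by
    intro x hx
    rw [mem_closedBall_zero_iff] at hx
    have hu : ‖x * (p : ℚ_[p]) ^ (n + 1)‖ ≤ 1 := by
      rw [norm_mul, Padic.norm_p_zpow, zpow_neg, ← div_eq_mul_inv]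
      exact div_le_one_of_le₀ hx (zpow_pos hp _).le
    obtain ⟨u, hu'⟩ : ∃ u : ℤ_[p], (u : ℚ_[p]) = x * (p : ℚ_[p]) ^ (n + 1) := ⟨⟨_, hu⟩, rfl⟩
    obtain ⟨d, hd, hmem⟩ := PadicInt.exists_mem_range u
    rw [IsLocalRing.mem_maximalIdeal, PadicInt.mem_nonunits] at hmem
    have hlt : ‖x * (p : ℚ_[p]) ^ (n + 1) - d‖ < 1 := by
      rwa [PadicInt.norm_def, PadicInt.coe_sub, PadicInt.coe_natCast, hu'] at hmem
    refine Set.mem_biUnion (Finset.mem_coe.2 (Finset.mem_range.2 hd)) ?_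
    rw [Metric.mem_closedBall, dist_eq_norm, Padic.norm_le_pow_iff_norm_lt_pow_add_one]
    have hx' : x - d * (p : ℚ_[p]) ^ (-(n + 1)) =
        (x * (p : ℚ_[p]) ^ (n + 1) - d) * (p : ℚ_[p]) ^ (-(n + 1)) := by
      rw [sub_mul, mul_assoc, ← zpow_add₀ hp', add_neg_cancel, zpow_zero, mul_one]
    rw [hx', norm_mul, Padic.norm_p_zpow, neg_neg]
    exact mul_lt_of_lt_one_left (zpow_pos hp _) hlt
  refine (measure_mono hsub).trans ((measure_biUnion_finset_le _ _).trans ?_)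
  simp [Measure.addHaar_closedBall_center]

theorem Padic.measure_closedBall_zpow_add_le (m : ℤ) (j : ℕ) :
    μ (Metric.closedBall 0 ((p : ℝ) ^ (m + j))) ≤
      (p : ENNReal) ^ j * μ (Metric.closedBall 0 ((p : ℝ) ^ m)) := by
  induction j with
  | zero => simp
  | succ j ih =>
    have h := Padic.measure_closedBall_zpow_add_one_le μ (m + j)
    rw [add_assoc] at h
    push_cast
    refine h.trans ?_
    rw [pow_succ', mul_assoc]
    gcongr

theorem Padic.integrable_indicator_norm_sq_inv {δ : ℝ} (hδ : 0 < δ) :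
    Integrable ({z : ℚ_[p] | δ ≤ ‖z‖}.indicator fun z => (‖z‖ ^ 2)⁻¹) μ := by
  have hp1 : (1 : ℝ) < p := mod_cast (Fact.out : p.Prime).one_lt
  have hp : (0 : ℝ) < p := one_pos.trans hp1
  have hmeas : MeasurableSet {z : ℚ_[p] | δ ≤ ‖z‖} :=
    measurableSet_le measurable_const measurable_norm
  refine ⟨(Measurable.indicator (by fun_prop) hmeas).aestronglyMeasurable, ?_⟩
  obtain ⟨m, hm⟩ : ∃ m : ℕ, (p : ℝ) ^ (-m : ℤ) < δ := by
    obtain ⟨m, hm⟩ := exists_pow_lt_of_lt_one hδ (inv_lt_one_of_one_lt₀ hp1)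
    exact ⟨m, by simpa using hm⟩
  set B : ℕ → Set ℚ_[p] := fun j => Metric.closedBall 0 ((p : ℝ) ^ (-m + j : ℤ))
  set c : ℕ → ENNReal := fun j => ENNReal.ofReal (((p : ℝ) ^ (-m + j : ℤ)) ^ 2)⁻¹
  have hle : ∀ z : ℚ_[p], ‖{z : ℚ_[p] | δ ≤ ‖z‖}.indicator (fun z => (‖z‖ ^ 2)⁻¹) z‖ₑ ≤
      ∑' j, (B j).indicator (fun _ => c j) z := by
    intro z
    by_cases hz : δ ≤ ‖z‖
    · have hz0 : z ≠ 0 := norm_pos_iff.1 (hδ.trans_le hz)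
      have hv := Padic.norm_eq_zpow_neg_valuation hz0
      have hlt : (-m : ℤ) < -z.valuation := by
        rw [← zpow_lt_zpow_iff_right₀ hp1, ← hv]
        exact hm.trans_le hz
      obtain ⟨j, hj⟩ := Int.eq_ofNat_of_zero_le (sub_nonneg.2 hlt.le)
      have hj' : (-m + j : ℤ) = -z.valuation := by omega
      have hn : ‖z‖ = (p : ℝ) ^ (-m + j : ℤ) := by rw [hj', hv]
      refine le_trans ?_ (ENNReal.le_tsum j)
      rw [Set.indicator_of_mem (show z ∈ {z : ℚ_[p] | δ ≤ ‖z‖} from hz),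
        Set.indicator_of_mem (show z ∈ B j from mem_closedBall_zero_iff.2 hn.le),
        Real.enorm_of_nonneg (by positivity), hn]
    · simp [hz]
  have hterm : ∀ j, c j * μ (B j) ≤
      (ENNReal.ofReal (((p : ℝ) ^ (-m : ℤ)) ^ 2)⁻¹ *
        μ (Metric.closedBall 0 ((p : ℝ) ^ (-m : ℤ)))) * ENNReal.ofReal ((p : ℝ)⁻¹ ^ j) := by
    intro j
    have hc : c j * (p : ENNReal) ^ j =
        ENNReal.ofReal (((p : ℝ) ^ (-m : ℤ)) ^ 2)⁻¹ * ENNReal.ofReal ((p : ℝ)⁻¹ ^ j) := by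
      rw [← ENNReal.ofReal_natCast, ← ENNReal.ofReal_pow hp.le,
        ← ENNReal.ofReal_mul (by positivity), ← ENNReal.ofReal_mul (by positivity)]
      congr 1
      rw [zpow_add₀ hp.ne', zpow_natCast, inv_pow]
      field_simp
    calc c j * μ (B j)
        ≤ c j * ((p : ENNReal) ^ j * μ (Metric.closedBall 0 ((p : ℝ) ^ (-m : ℤ)))) := by
          gcongr
          exact Padic.measure_closedBall_zpow_add_le μ _ j
      _ = _ := by rw [← mul_assoc, hc]; ring
  have hsum : ∑' j : ℕ, ENNReal.ofReal ((p : ℝ)⁻¹ ^ j) < ⊤ := by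
    have hs := summable_geometric_of_lt_one (inv_nonneg.2 hp.le) (inv_lt_one_of_one_lt₀ hp1)
    rw [← ENNReal.ofReal_tsum_of_nonneg (fun j => by positivity) hs]
    exact ENNReal.ofReal_lt_top
  calc ∫⁻ z, ‖{z : ℚ_[p] | δ ≤ ‖z‖}.indicator (fun z => (‖z‖ ^ 2)⁻¹) z‖ₑ ∂μ
      ≤ ∫⁻ z, ∑' j, (B j).indicator (fun _ => c j) z ∂μ := lintegral_mono hle
    _ = ∑' j, c j * μ (B j) := by
      rw [lintegral_tsum fun j =>
        (measurable_const.indicator Metric.isClosed_closedBall.measurableSet).aemeasurable]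
      exact tsum_congr fun j => lintegral_indicator_const Metric.isClosed_closedBall.measurableSet _
    _ ≤ _ := ENNReal.tsum_le_tsum hterm
    _ < ⊤ := by
      rw [ENNReal.tsum_mul_left]
      exact ENNReal.mul_lt_top
        (ENNReal.mul_lt_top ENNReal.ofReal_lt_top measure_closedBall_lt_top) hsum

end Padic

theorem stmt0 {p : ℕ} [Fact p.Prime] [MeasurableSpace ℚ_[p]] [BorelSpace ℚ_[p]]
    (μ : Measure ℚ_[p]) [μ.IsAddHaarMeasure]
    (hμ : μ {x : ℚ_[p] | ‖x‖ ≤ 1} = 1)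
    (φ : ℚ_[p] → ℝ) (hφ : IsTestFunction φ) :
    Integrable (fun q : ℚ_[p] × ℚ_[p] => ((φ q.1 - φ q.2) / ‖q.1 - q.2‖) ^ 2) (μ.prod μ) ∧
    (∀ x : ℚ_[p], Integrable (fun y => (φ x - φ y) / ‖x - y‖ ^ 2) μ) ∧
    ∫ x, (∫ y, ((φ x - φ y) / ‖x - y‖) ^ 2 ∂μ) ∂μ =
      2 * ∫ x, φ x * (∫ y, (φ x - φ y) / ‖x - y‖ ^ 2 ∂μ) ∂μ := by
  have hcont := hφ.isLocallyConstant.continuous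
  have hm : Measurable φ := hcont.measurable
  obtain ⟨C, hC⟩ := hφ.2.exists_bound_of_continuous hcont
  obtain ⟨δ, hδ, hloc⟩ := hφ.exists_eq_of_norm_sub_lt
  have hdiff : ∀ x y, ‖φ x - φ y‖ ≤ C + C := fun x y =>
    (norm_sub_le _ _).trans (add_le_add (hC x) (hC y))
  set k : ℚ_[p] → ℝ := {z : ℚ_[p] | δ ≤ ‖z‖}.indicator fun z => (‖z‖ ^ 2)⁻¹ with hk
  have hkint : Integrable k μ := Padic.integrable_indicator_norm_sq_inv μ hδ
  have hdiv : ∀ x y, (φ x - φ y) / ‖x - y‖ ^ 2 = k (x - y) * (φ x - φ y) := by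
    intro x y
    by_cases h : δ ≤ ‖x - y‖
    · simp [hk, h, div_eq_inv_mul]
    · simp [hloc x y (not_le.1 h)]
  have hF : Integrable (fun q : ℚ_[p] × ℚ_[p] => φ q.1 * ((φ q.1 - φ q.2) / ‖q.1 - q.2‖ ^ 2))
      (μ.prod μ) := by
    have h1 : Integrable (fun q : ℚ_[p] × ℚ_[p] => φ q.1 * k (-q.1 + q.2)) (μ.prod μ) :=
      (measurePreserving_prod_neg_add μ μ).integrable_comp_of_integrable
        ((hcont.integrable_of_hasCompactSupport hφ.2).mul_prod hkint)
    refine (h1.mul_bdd (c := C + C) (g := fun q => φ q.1 - φ q.2)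
      (by fun_prop) (.of_forall fun q => hdiff _ _)).congr (.of_forall fun q => ?_)
    have hsymm : k (-q.1 + q.2) = k (q.1 - q.2) := by
      have hn : -q.1 + q.2 = -(q.1 - q.2) := by ring
      rw [hn]
      simp only [hk, Set.indicator, Set.mem_ofPred_eq, norm_neg]
    simp only [hdiv, hsymm, mul_assoc]
  have hsq : ∀ q : ℚ_[p] × ℚ_[p], ((φ q.1 - φ q.2) / ‖q.1 - q.2‖) ^ 2 =
      φ q.1 * ((φ q.1 - φ q.2) / ‖q.1 - q.2‖ ^ 2) +
      φ q.swap.1 * ((φ q.swap.1 - φ q.swap.2) / ‖q.swap.1 - q.swap.2‖ ^ 2) := by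
    intro q
    rw [Prod.fst_swap, Prod.snd_swap, norm_sub_rev q.2 q.1]
    ring
  have hG : Integrable (fun q : ℚ_[p] × ℚ_[p] => ((φ q.1 - φ q.2) / ‖q.1 - q.2‖) ^ 2)
      (μ.prod μ) := by
    simp only [hsq]
    exact hF.add hF.swap
  refine ⟨hG, fun x => ?_, ?_⟩
  · simp only [hdiv]
    exact (hkint.comp_sub_left x).mul_bdd (c := C + C) (by fun_prop) (.of_forall fun y => hdiff x y)
  · rw [integral_integral (f := fun x y => ((φ x - φ y) / ‖x - y‖) ^ 2) hG]
    have hmul : ∀ x, φ x * ∫ y, (φ x - φ y) / ‖x - y‖ ^ 2 ∂μ =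
        ∫ y, φ x * ((φ x - φ y) / ‖x - y‖ ^ 2) ∂μ := fun x => (integral_const_mul _ _).symm
    simp only [hmul]
    rw [integral_integral (f := fun x y => φ x * ((φ x - φ y) / ‖x - y‖ ^ 2)) hF]
    simp only [hsq]
    refine (integral_add hF hF.swap).trans ?_
    rw [two_mul]
    congr 1
    exact integral_prod_swap fun q : ℚ_[p] × ℚ_[p] =>
      φ q.1 * ((φ q.1 - φ q.2) / ‖q.1 - q.2‖ ^ 2)
end

section
/- For every m ∈ ℚ_p with m ≠ 0, the function J_{L,m} is locally constant, has compact support, and satisfies ∫_{ℚ_p} J_{L,m} dμ = 0 (i.e. J_{L,m} belongs to the real Lizorkin space of test functions of the second kind). -/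
open MeasureTheory

/-- `δ_L`: `p^L` times the indicator of the ball `{x : |x|_p ≤ p^{-L}}`. -/
noncomputable def deltaL (p : ℕ) [Fact p.Prime] (L : ℕ) (x : ℚ_[p]) : ℝ :=
  if ‖x‖ ≤ (p : ℝ) ^ (-(L : ℤ)) then (p : ℝ) ^ L else 0

/-- `J_L(x) = Σ_j v_j δ_L(x − x_j)`. -/
noncomputable def JL (p : ℕ) [Fact p.Prime] (L : ℕ) {N : ℕ} (v : Fin N → ℝ)
    (xs : Fin N → ℚ_[p]) (x : ℚ_[p]) : ℝ :=
  ∑ j, v j * deltaL p L (x - xs j)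

/-- `Ω_m`: `|m|_p^{-1}` times the indicator of the ball `{x : |x|_p ≤ |m|_p}`. -/
noncomputable def OmegaM (p : ℕ) [Fact p.Prime] (m : ℚ_[p]) (x : ℚ_[p]) : ℝ :=
  if ‖x‖ ≤ ‖m‖ then ‖m‖⁻¹ else 0

/-- `J_{L,m}(x) = J_L(x) − Σ_j v_j (Ω_m ⋆ δ_L(· − x_j))(x)`. -/
noncomputable def JLm (p : ℕ) [Fact p.Prime] [MeasurableSpace ℚ_[p]]
    (μ : Measure ℚ_[p]) (L : ℕ) {N : ℕ} (v : Fin N → ℝ) (xs : Fin N → ℚ_[p])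
    (m : ℚ_[p]) (x : ℚ_[p]) : ℝ :=
  JL p L v xs x - ∑ j, v j * ∫ y, OmegaM p m (x - y) * deltaL p L (y - xs j) ∂μ

namespace Padic

variable {p : ℕ} [Fact p.Prime]

theorem norm_add_le_iff_of_norm_le {r : ℝ} {x x' : ℚ_[p]} (hx' : ‖x'‖ ≤ r) :
    ‖x + x'‖ ≤ r ↔ ‖x‖ ≤ r := by
  refine ⟨fun h => ?_, fun h => (Padic.nonarchimedean x x').trans (max_le h hx')⟩
  have := Padic.nonarchimedean (x + x') (-x')
  rw [add_neg_cancel_right, norm_neg] at this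
  exact this.trans (max_le h hx')

/-- A ball of radius `p ^ (n + 1)` is a disjoint union of `p` balls of radius `p ^ n`. -/
theorem measure_closedBall_zpow_add_one [MeasurableSpace ℚ_[p]] [BorelSpace ℚ_[p]]
    (μ : Measure ℚ_[p]) [μ.IsAddHaarMeasure] (n : ℤ) :
    μ (Metric.closedBall 0 ((p : ℝ) ^ (n + 1))) = p * μ (Metric.closedBall 0 ((p : ℝ) ^ n)) := by
  have hp : (0 : ℝ) < p := by exact_mod_cast (Fact.out : p.Prime).pos
  have hp0 : (p : ℚ_[p]) ≠ 0 := by exact_mod_cast (Fact.out : p.Prime).ne_zero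
  set u : ℚ_[p] := (p : ℚ_[p]) ^ (n + 1)
  have hu0 : u ≠ 0 := zpow_ne_zero _ hp0
  have hnu : ‖u‖ = (p : ℝ) ^ (-(n + 1)) := Padic.norm_p_zpow _
  have hscale (y : ℚ_[p]) (k : ℤ) : ‖y‖ ≤ (p : ℝ) ^ k ↔ ‖u * y‖ ≤ (p : ℝ) ^ (k - (n + 1)) := by
    rw [norm_mul, hnu, sub_eq_neg_add, zpow_add₀ hp.ne', mul_le_mul_iff_right₀ (zpow_pos hp _)]
  have hmem (x : ℚ_[p]) (i : ℕ) :
      x ∈ Metric.closedBall ((i : ℚ_[p]) / u) ((p : ℝ) ^ n) ↔ ‖u * x - i‖ < 1 := by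
    rw [mem_closedBall_iff_norm, hscale, mul_sub, mul_div_cancel₀ _ hu0,
      norm_le_pow_iff_norm_lt_pow_add_one]
    simp
  have norm_le_one (y : ℚ_[p]) (i : ℕ) (h : ‖y - i‖ < 1) : ‖y‖ ≤ 1 := by
    have := Padic.nonarchimedean (y - (i : ℚ_[p])) i
    rw [sub_add_cancel] at this
    exact this.trans (max_le h.le (by simpa using Padic.norm_int_le_one (p := p) i))
  have hunion : Metric.closedBall (0 : ℚ_[p]) ((p : ℝ) ^ (n + 1)) =
      ⋃ i ∈ Finset.range p, Metric.closedBall ((i : ℚ_[p]) / u) ((p : ℝ) ^ n) := by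
    ext x
    simp only [Set.mem_iUnion, hmem, Finset.mem_range, exists_prop]
    rw [mem_closedBall_zero_iff, hscale, sub_self, zpow_zero]
    constructor
    · intro h
      obtain ⟨z, hz⟩ : ∃ z : ℤ_[p], (z : ℚ_[p]) = u * x := ⟨⟨u * x, h⟩, rfl⟩
      rw [← hz]
      exact ⟨z.zmodRepr, z.zmodRepr_lt_p, by exact_mod_cast z.norm_sub_zmodRepr_lt_one⟩
    · rintro ⟨i, -, h⟩
      exact norm_le_one _ i h
  have hdisj : (Finset.range p : Set ℕ).PairwiseDisjoint
      fun i => Metric.closedBall ((i : ℚ_[p]) / u) ((p : ℝ) ^ n) := by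
    intro i hi j hj hij
    refine Set.disjoint_left.2 fun x hxi hxj => hij ?_
    rw [hmem] at hxi hxj
    obtain ⟨z, hz⟩ : ∃ z : ℤ_[p], (z : ℚ_[p]) = u * x := ⟨⟨u * x, norm_le_one _ _ hxi⟩, rfl⟩
    rw [← hz] at hxi hxj
    have key (k : ℕ) (hk : k ∈ Finset.range p) (h : ‖(z : ℚ_[p]) - k‖ < 1) : z.zmodRepr = k := by
      refine z.zmodRepr_unique k (Finset.mem_range.1 hk) ?_
      rw [IsLocalRing.mem_maximalIdeal, PadicInt.mem_nonunits]
      exact_mod_cast h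
    rw [← key i hi hxi, key j hj hxj]
  rw [hunion, measure_biUnion_finset hdisj fun _ _ => Metric.isClosed_closedBall.measurableSet]
  simp [fun i : ℕ => Measure.addHaar_closedBall_center μ ((i : ℚ_[p]) / u) ((p : ℝ) ^ n)]

theorem measureReal_closedBall_zpow [MeasurableSpace ℚ_[p]] [BorelSpace ℚ_[p]]
    (μ : Measure ℚ_[p]) [μ.IsAddHaarMeasure] (hμ : μ {x : ℚ_[p] | ‖x‖ ≤ 1} = 1) (n : ℤ) :
    μ.real (Metric.closedBall 0 ((p : ℝ) ^ n)) = (p : ℝ) ^ n := by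
  have hp : (p : ℝ) ≠ 0 := by exact_mod_cast (Fact.out : p.Prime).ne_zero
  have step (k : ℤ) : μ.real (Metric.closedBall 0 ((p : ℝ) ^ (k + 1))) =
      p * μ.real (Metric.closedBall 0 ((p : ℝ) ^ k)) := by
    simp [measureReal_def, measure_closedBall_zpow_add_one]
  induction n using Int.induction_on with
  | zero =>
    have : Metric.closedBall (0 : ℚ_[p]) 1 = {x | ‖x‖ ≤ 1} := by ext; simp
    simp [measureReal_def, this, hμ]
  | succ k ih => rw [step, ih, zpow_add_one₀ hp, mul_comm]
  | pred k ih =>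
    have h := step (-k - 1)
    rw [sub_add_cancel, ih] at h
    exact mul_left_cancel₀ hp (by rw [← h, ← zpow_one_add₀ hp, add_sub_cancel])

end Padic

namespace IsTestFunction

variable {p : ℕ} [Fact p.Prime] {f g : ℚ_[p] → ℝ}

theorem of_norm_le_zpow (k : ℤ) (c : ℝ) :
    IsTestFunction fun x : ℚ_[p] => if ‖x‖ ≤ (p : ℝ) ^ k then c else 0 := by
  refine ⟨fun x => ⟨-k, fun x' hx' => ?_⟩, ?_⟩
  · rw [neg_neg] at hx'
    simp only [Padic.norm_add_le_iff_of_norm_le hx']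
  · refine HasCompactSupport.intro (isCompact_closedBall (0 : ℚ_[p]) ((p : ℝ) ^ k)) fun x hx => ?_
    rw [mem_closedBall_zero_iff] at hx
    exact if_neg hx

theorem continuous (hf : IsTestFunction f) : Continuous f := by
  have hp : (0 : ℝ) < p := by exact_mod_cast (Fact.out : p.Prime).pos
  refine continuous_iff_continuousAt.2 fun x => ?_
  obtain ⟨l, hl⟩ := hf.1 x
  refine (continuousAt_const (y := f x)).congr ?_
  filter_upwards [Metric.closedBall_mem_nhds x (zpow_pos hp (-l))] with y hy
  rw [mem_closedBall_iff_norm] at hy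
  simpa using (hl _ hy).symm

theorem integrable [MeasurableSpace ℚ_[p]] [BorelSpace ℚ_[p]] (hf : IsTestFunction f)
    (μ : Measure ℚ_[p]) [IsFiniteMeasureOnCompacts μ] : Integrable f μ :=
  hf.continuous.integrable_of_hasCompactSupport hf.2

theorem comp_sub_right (hf : IsTestFunction f) (a : ℚ_[p]) :
    IsTestFunction fun x => f (x - a) := by
  refine ⟨fun x => ?_, hf.2.comp_homeomorph (Homeomorph.subRight a)⟩
  obtain ⟨l, hl⟩ := hf.1 (x - a)
  exact ⟨l, fun x' hx' => by simp only [add_sub_right_comm, hl x' hx']⟩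

theorem const_mul (hf : IsTestFunction f) (c : ℝ) : IsTestFunction fun x => c * f x := by
  refine ⟨fun x => ?_, hf.2.mul_left⟩
  obtain ⟨l, hl⟩ := hf.1 x
  exact ⟨l, fun x' hx' => by simp only [hl x' hx']⟩

theorem add (hf : IsTestFunction f) (hg : IsTestFunction g) :
    IsTestFunction fun x => f x + g x := by
  have hp : (1 : ℝ) ≤ p := by exact_mod_cast (Fact.out : p.Prime).one_le
  refine ⟨fun x => ?_, hf.2.add hg.2⟩
  obtain ⟨l, hl⟩ := hf.1 x
  obtain ⟨k, hk⟩ := hg.1 x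
  refine ⟨max l k, fun x' hx' => ?_⟩
  simp only [hl x' (hx'.trans (zpow_le_zpow_right₀ hp (by grind))),
    hk x' (hx'.trans (zpow_le_zpow_right₀ hp (by grind)))]

theorem sub (hf : IsTestFunction f) (hg : IsTestFunction g) :
    IsTestFunction fun x => f x - g x := by
  simpa [sub_eq_add_neg] using hf.add (hg.const_mul (-1))

theorem sum {ι : Type*} (s : Finset ι) {F : ι → ℚ_[p] → ℝ} (hF : ∀ i ∈ s, IsTestFunction (F i)) :
    IsTestFunction fun x => ∑ i ∈ s, F i x := by
  classical
  induction s using Finset.induction_on with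
  | empty => exact ⟨fun _ => ⟨0, fun _ _ => rfl⟩, HasCompactSupport.zero⟩
  | insert i s hi ih =>
    simp only [Finset.sum_insert hi]
    exact (hF i (by simp)).add (ih fun j hj => hF j (by simp [hj]))

end IsTestFunction

section Smoothing

open scoped Convolution

variable {p : ℕ} [Fact p.Prime]

theorem isTestFunction_deltaL (L : ℕ) : IsTestFunction (deltaL p L) :=
  IsTestFunction.of_norm_le_zpow _ _

theorem isTestFunction_OmegaM {m : ℚ_[p]} (hm : m ≠ 0) : IsTestFunction (OmegaM p m) := by
  unfold OmegaM
  rw [Padic.norm_eq_zpow_neg_valuation hm]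
  exact IsTestFunction.of_norm_le_zpow _ _

variable [MeasurableSpace ℚ_[p]] (μ : Measure ℚ_[p])

theorem integral_OmegaM [BorelSpace ℚ_[p]] [μ.IsAddHaarMeasure]
    (hμ : μ {x : ℚ_[p] | ‖x‖ ≤ 1} = 1) {m : ℚ_[p]} (hm : m ≠ 0) :
    ∫ x, OmegaM p m x ∂μ = 1 := by
  have h : OmegaM p m = (Metric.closedBall 0 ‖m‖).indicator fun _ => ‖m‖⁻¹ := by
    ext x
    classical
    simp only [Set.indicator_apply, mem_closedBall_zero_iff, OmegaM]
  have hball : μ.real (Metric.closedBall 0 ‖m‖) = ‖m‖ := by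
    rw [Padic.norm_eq_zpow_neg_valuation hm, Padic.measureReal_closedBall_zpow μ hμ]
  rw [h, integral_indicator_const _ Metric.isClosed_closedBall.measurableSet, hball, smul_eq_mul,
    mul_inv_cancel₀ (norm_ne_zero_iff.2 hm)]

theorem integral_OmegaM_mul_eq_convolution (m : ℚ_[p]) (g : ℚ_[p] → ℝ) :
    (fun x => ∫ y, OmegaM p m (x - y) * g y ∂μ) =
      g ⋆[ContinuousLinearMap.mul ℝ ℝ, μ] OmegaM p m := by
  ext x
  simp [convolution_def, mul_comm]

theorem IsTestFunction.integral_OmegaM_mul {m : ℚ_[p]} (hm : m ≠ 0) {g : ℚ_[p] → ℝ}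
    (hg : IsTestFunction g) : IsTestFunction fun x => ∫ y, OmegaM p m (x - y) * g y ∂μ := by
  constructor
  · refine fun x => ⟨m.valuation, fun x' hx' => ?_⟩
    rw [← Padic.norm_eq_zpow_neg_valuation hm] at hx'
    simp only [OmegaM, add_sub_right_comm, Padic.norm_add_le_iff_of_norm_le hx']
  · rw [integral_OmegaM_mul_eq_convolution]
    exact hg.2.convolution _ (isTestFunction_OmegaM hm).2

theorem integral_integral_OmegaM_mul [BorelSpace ℚ_[p]] [μ.IsAddHaarMeasure]
    (hμ : μ {x : ℚ_[p] | ‖x‖ ≤ 1} = 1) {m : ℚ_[p]} (hm : m ≠ 0) {g : ℚ_[p] → ℝ}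
    (hg : IsTestFunction g) :
    ∫ x, ∫ y, OmegaM p m (x - y) * g y ∂μ ∂μ = ∫ x, g x ∂μ := by
  rw [integral_OmegaM_mul_eq_convolution, integral_convolution _ (hg.integrable μ)
    ((isTestFunction_OmegaM hm).integrable μ), integral_OmegaM μ hμ hm]
  simp

end Smoothing

theorem stmt3 {p : ℕ} [Fact p.Prime] [MeasurableSpace ℚ_[p]] [BorelSpace ℚ_[p]]
    (μ : Measure ℚ_[p]) [μ.IsAddHaarMeasure]
    (hμ : μ {x : ℚ_[p] | ‖x‖ ≤ 1} = 1)
    (L : ℕ) (hL : 0 < L) {N : ℕ} (v : Fin N → ℝ) (xs : Fin N → ℚ_[p])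
    (hxs : Function.Injective xs)
    (m : ℚ_[p]) (hm : m ≠ 0) :
    IsTestFunction (JLm p μ L v xs m) ∧ ∫ x, JLm p μ L v xs m x ∂μ = 0 := by
  have hδ (j : Fin N) : IsTestFunction fun x => deltaL p L (x - xs j) :=
    (isTestFunction_deltaL L).comp_sub_right (xs j)
  have hΩ (j : Fin N) := (hδ j).integral_OmegaM_mul μ hm
  have hJ : IsTestFunction (JL p L v xs) := IsTestFunction.sum _ fun j _ => (hδ j).const_mul (v j)
  have hC := IsTestFunction.sum Finset.univ fun j _ => (hΩ j).const_mul (v j)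
  refine ⟨hJ.sub hC, ?_⟩
  unfold JLm
  rw [integral_sub (hJ.integrable μ) (hC.integrable μ), sub_eq_zero]
  unfold JL
  rw [integral_finsetSum _ fun j _ => ((hδ j).const_mul (v j)).integrable μ,
    integral_finsetSum _ fun j _ => ((hΩ j).const_mul (v j)).integrable μ]
  refine Finset.sum_congr rfl fun j _ => ?_
  rw [integral_const_mul, integral_const_mul, integral_integral_OmegaM_mul μ hμ hm (hδ j)]
end

section
/- Let 1 < ρ < ∞. Then J_{L,m} converges to J_L in L^ρ(ℚ_p, μ) as |m|_p → ∞: for every ε > 0 there exists M > 0 such that for every m ∈ ℚ_p with |m|_p ≥ M one has ( ∫_{ℚ_p} |J_{L,m}(x) − J_L(x)|^ρ dμ(x) )^{1/ρ} < ε. -/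
open MeasureTheory

/-- The ball of radius `‖m‖ ≥ 1` is covered by `‖m‖` translates of the unit ball. -/
theorem measure_padic_ball_le {p : ℕ} [Fact p.Prime] [MeasurableSpace ℚ_[p]] [BorelSpace ℚ_[p]]
    (μ : Measure ℚ_[p]) [μ.IsAddHaarMeasure] (hμ : μ {x : ℚ_[p] | ‖x‖ ≤ 1} = 1)
    (m : ℚ_[p]) (hm : 1 ≤ ‖m‖) :
    μ {x : ℚ_[p] | ‖x‖ ≤ ‖m‖} ≤ ENNReal.ofReal ‖m‖ := by
  have hp : (1 : ℝ) < p := by exact_mod_cast (Fact.out : p.Prime).one_lt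
  have hp0 : (p : ℚ_[p]) ≠ 0 := by exact_mod_cast (Fact.out : p.Prime).ne_zero
  have hm0 : m ≠ 0 := by
    rintro rfl
    simp at hm
    linarith
  obtain ⟨k, hk⟩ : ∃ k : ℕ, ‖m‖ = (p : ℝ) ^ k := by
    have h := Padic.norm_eq_zpow_neg_valuation hm0
    have h0 : 0 ≤ -m.valuation := by
      rw [h] at hm
      exact (one_le_zpow_iff_right₀ hp).1 hm
    obtain ⟨k, hk⟩ := Int.eq_ofNat_of_zero_le h0
    exact ⟨k, by rw [h, hk, zpow_natCast]⟩
  have hcover : {x : ℚ_[p] | ‖x‖ ≤ ‖m‖} ⊆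
      ⋃ a ∈ Finset.range (p ^ k),
        (fun x : ℚ_[p] => -((a : ℚ_[p]) / (p : ℚ_[p]) ^ k) + x) ⁻¹' {x : ℚ_[p] | ‖x‖ ≤ 1} := by
    intro x hx
    have hpk : ‖(p : ℚ_[p]) ^ k‖ = ((p : ℝ) ^ k)⁻¹ := by simp
    have hpk0 : (0 : ℝ) < (p : ℝ) ^ k := by positivity
    have hy : ‖(p : ℚ_[p]) ^ k * x‖ ≤ 1 := by
      rw [norm_mul, hpk, inv_mul_le_iff₀ hpk0, mul_one, ← hk]
      exact hx
    obtain ⟨y, hyx⟩ : ∃ y : ℤ_[p], (y : ℚ_[p]) = (p : ℚ_[p]) ^ k * x := ⟨⟨_, hy⟩, rfl⟩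
    obtain ⟨z, hz⟩ := Ideal.mem_span_singleton.1 (PadicInt.appr_spec k y)
    have hz' : (p : ℚ_[p]) ^ k * x - (y.appr k : ℚ_[p]) = (p : ℚ_[p]) ^ k * z := by
      have := congrArg (fun t : ℤ_[p] => (t : ℚ_[p])) hz
      simpa [hyx] using this
    simp only [Set.mem_iUnion, Finset.mem_range, Set.mem_preimage, Set.mem_ofPred_eq]
    refine ⟨y.appr k, PadicInt.appr_lt y k, ?_⟩
    have hxz : -((y.appr k : ℚ_[p]) / (p : ℚ_[p]) ^ k) + x = z := by
      field_simp
      linear_combination hz'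
    rw [hxz]
    exact z.2
  calc μ {x : ℚ_[p] | ‖x‖ ≤ ‖m‖}
      ≤ ∑ a ∈ Finset.range (p ^ k),
          μ ((fun x : ℚ_[p] => -((a : ℚ_[p]) / (p : ℚ_[p]) ^ k) + x) ⁻¹'
            {x : ℚ_[p] | ‖x‖ ≤ 1}) :=
        (measure_mono hcover).trans (measure_biUnion_finset_le _ _)
    _ = ENNReal.ofReal ‖m‖ := by
        simp only [measure_preimage_add, hμ]
        rw [hk, ENNReal.ofReal_pow (by positivity)]
        simp

theorem deltaL_nonneg (p : ℕ) [Fact p.Prime] (L : ℕ) (x : ℚ_[p]) : 0 ≤ deltaL p L x := by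
  unfold deltaL
  split_ifs <;> positivity

theorem norm_le_one_of_deltaL_ne_zero {p : ℕ} [Fact p.Prime] {L : ℕ} {x : ℚ_[p]}
    (hx : deltaL p L x ≠ 0) : ‖x‖ ≤ 1 := by
  have hp : (1 : ℝ) ≤ p := by exact_mod_cast (Fact.out : p.Prime).one_lt.le
  have h : ‖x‖ ≤ (p : ℝ) ^ (-(L : ℤ)) := by
    by_contra h
    exact hx (if_neg h)
  exact h.trans (zpow_le_one_of_nonpos₀ hp (by simp))

theorem measurableSet_padic_ball {p : ℕ} [Fact p.Prime] [MeasurableSpace ℚ_[p]]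
    [BorelSpace ℚ_[p]] (r : ℝ) : MeasurableSet {x : ℚ_[p] | ‖x‖ ≤ r} :=
  (isClosed_le continuous_norm continuous_const).measurableSet

theorem measure_padic_ball_lt_top {p : ℕ} [Fact p.Prime] [MeasurableSpace ℚ_[p]]
    [BorelSpace ℚ_[p]] (μ : Measure ℚ_[p]) [μ.IsAddHaarMeasure] (r : ℝ) :
    μ {x : ℚ_[p] | ‖x‖ ≤ r} < ⊤ := by
  have h : {x : ℚ_[p] | ‖x‖ ≤ r} = Metric.closedBall 0 r := by
    ext x
    simp
  rw [h]
  exact (isCompact_closedBall _ _).measure_lt_top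

theorem integrable_deltaL {p : ℕ} [Fact p.Prime] [MeasurableSpace ℚ_[p]] [BorelSpace ℚ_[p]]
    (μ : Measure ℚ_[p]) [μ.IsAddHaarMeasure] (L : ℕ) : Integrable (deltaL p L) μ := by
  have h : deltaL p L =
      {x : ℚ_[p] | ‖x‖ ≤ (p : ℝ) ^ (-(L : ℤ))}.indicator fun _ => (p : ℝ) ^ L := by
    ext x
    simp [deltaL, Set.indicator]
  rw [h, integrable_indicator_iff (measurableSet_padic_ball _)]
  exact integrableOn_const (measure_padic_ball_lt_top μ _).ne

theorem abs_OmegaM_le {p : ℕ} [Fact p.Prime] (m x : ℚ_[p]) : |OmegaM p m x| ≤ ‖m‖⁻¹ := by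
  unfold OmegaM
  split_ifs
  · rw [abs_of_nonneg (by positivity)]
  · simp

theorem abs_integral_OmegaM_mul_deltaL_le {p : ℕ} [Fact p.Prime] [MeasurableSpace ℚ_[p]]
    [BorelSpace ℚ_[p]] (μ : Measure ℚ_[p]) [μ.IsAddHaarMeasure] (L : ℕ) (m a x : ℚ_[p]) :
    |∫ y, OmegaM p m (x - y) * deltaL p L (y - a) ∂μ| ≤ ‖m‖⁻¹ * ∫ y, deltaL p L y ∂μ := by
  rw [← integral_sub_right_eq_self (deltaL p L) a, ← integral_const_mul]
  refine norm_integral_le_of_norm_le (G := ℝ)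
    (((integrable_deltaL μ L).comp_sub_right a).const_mul _) (Filter.Eventually.of_forall fun y => ?_)
  rw [Real.norm_eq_abs, abs_mul, abs_of_nonneg (deltaL_nonneg p L _)]
  exact mul_le_mul_of_nonneg_right (abs_OmegaM_le m _) (deltaL_nonneg p L _)

theorem integral_OmegaM_mul_deltaL_eq_zero {p : ℕ} [Fact p.Prime] [MeasurableSpace ℚ_[p]]
    (μ : Measure ℚ_[p]) (L : ℕ) {m a x : ℚ_[p]} (hm : 1 ≤ ‖m‖) (ha : ‖a‖ ≤ ‖m‖)
    (hx : ‖m‖ < ‖x‖) : ∫ y, OmegaM p m (x - y) * deltaL p L (y - a) ∂μ = 0 := by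
  refine integral_eq_zero_of_ae (Filter.Eventually.of_forall fun y => ?_)
  show OmegaM p m (x - y) * deltaL p L (y - a) = 0
  by_cases hy : deltaL p L (y - a) = 0
  · simp [hy]
  have h1 : ‖y - a‖ ≤ ‖m‖ := (norm_le_one_of_deltaL_ne_zero hy).trans hm
  have h2 : ‖y‖ ≤ ‖m‖ := by
    have h := Padic.nonarchimedean (y - a) a
    rw [sub_add_cancel] at h
    exact h.trans (max_le h1 ha)
  have h3 : ¬ ‖x - y‖ ≤ ‖m‖ := by
    intro h3
    have h := Padic.nonarchimedean (x - y) y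
    rw [sub_add_cancel] at h
    exact absurd (h.trans (max_le h3 h2)) (not_le.2 hx)
  simp [OmegaM, h3]

/-- `J_{L,m} - J_L` is bounded by a multiple of `Ω_m`. -/
theorem abs_JLm_sub_JL_le {p : ℕ} [Fact p.Prime] [MeasurableSpace ℚ_[p]] [BorelSpace ℚ_[p]]
    (μ : Measure ℚ_[p]) [μ.IsAddHaarMeasure] (L : ℕ) {N : ℕ} (v : Fin N → ℝ)
    (xs : Fin N → ℚ_[p]) {m : ℚ_[p]} (hm : 1 ≤ ‖m‖) (hxm : ∀ j, ‖xs j‖ ≤ ‖m‖) (x : ℚ_[p]) :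
    |JLm p μ L v xs m x - JL p L v xs x| ≤
      {x : ℚ_[p] | ‖x‖ ≤ ‖m‖}.indicator
        (fun _ => ((∑ j, |v j|) * ∫ y, deltaL p L y ∂μ) * ‖m‖⁻¹) x := by
  rw [JLm, sub_sub_cancel_left, abs_neg]
  by_cases hx : ‖x‖ ≤ ‖m‖
  · rw [Set.indicator_of_mem (by exact hx), mul_assoc, Finset.sum_mul]
    refine (Finset.abs_sum_le_sum_abs _ _).trans (Finset.sum_le_sum fun j _ => ?_)
    rw [abs_mul, mul_comm (∫ y, deltaL p L y ∂μ)]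
    exact mul_le_mul_of_nonneg_left (abs_integral_OmegaM_mul_deltaL_le μ L m _ x) (abs_nonneg _)
  · rw [Set.indicator_of_notMem (by exact hx)]
    simp [integral_OmegaM_mul_deltaL_eq_zero μ L hm (hxm _) (not_le.1 hx)]

theorem stmt4 {p : ℕ} [Fact p.Prime] [MeasurableSpace ℚ_[p]] [BorelSpace ℚ_[p]]
    (μ : Measure ℚ_[p]) [μ.IsAddHaarMeasure]
    (hμ : μ {x : ℚ_[p] | ‖x‖ ≤ 1} = 1)
    (L : ℕ) (hL : 0 < L) {N : ℕ} (v : Fin N → ℝ) (xs : Fin N → ℚ_[p])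
    (hxs : Function.Injective xs)
    (ρ : ℝ) (hρ : 1 < ρ) :
    ∀ ε > (0 : ℝ), ∃ M > (0 : ℝ), ∀ m : ℚ_[p], M ≤ ‖m‖ →
      (∫ x, |JLm p μ L v xs m x - JL p L v xs x| ^ ρ ∂μ) ^ (1 / ρ) < ε := by
  intro ε hε
  set K : ℝ := (∑ j, |v j|) * ∫ y, deltaL p L y ∂μ with hK
  have hK0 : 0 ≤ K :=
    mul_nonneg (Finset.sum_nonneg fun _ _ => abs_nonneg _) (integral_nonneg (deltaL_nonneg p L))
  have hρ0 : 0 < ρ := by linarith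
  have hlim : Filter.Tendsto (fun t : ℝ => K ^ ρ * t ^ (-(ρ - 1))) Filter.atTop (nhds 0) := by
    simpa using (tendsto_rpow_neg_atTop (sub_pos.2 hρ)).const_mul (K ^ ρ)
  obtain ⟨T, hT⟩ := Filter.eventually_atTop.1
    (hlim.eventually_lt_const (Real.rpow_pos_of_pos hε ρ))
  refine ⟨max 1 (max T (∑ j, ‖xs j‖)), by positivity, fun m hM => ?_⟩
  have hm : 1 ≤ ‖m‖ := (le_max_left _ _).trans hM
  have hTm : T ≤ ‖m‖ := ((le_max_left _ _).trans (le_max_right _ _)).trans hM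
  have hxm : ∀ j, ‖xs j‖ ≤ ‖m‖ := fun j =>
    (Finset.single_le_sum (f := fun j => ‖xs j‖) (fun _ _ => norm_nonneg _)
      (Finset.mem_univ j)).trans (((le_max_right _ _).trans (le_max_right _ _)).trans hM)
  have hm0 : 0 < ‖m‖ := by linarith
  have hle : ∫ x, |JLm p μ L v xs m x - JL p L v xs x| ^ ρ ∂μ ≤ K ^ ρ * ‖m‖ ^ (-(ρ - 1)) := by
    calc ∫ x, |JLm p μ L v xs m x - JL p L v xs x| ^ ρ ∂μ
        ≤ ∫ x, {x : ℚ_[p] | ‖x‖ ≤ ‖m‖}.indicator (fun _ => (K * ‖m‖⁻¹) ^ ρ) x ∂μ := by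
          refine integral_mono_of_nonneg (Filter.Eventually.of_forall fun x => by positivity) ?_
            (Filter.Eventually.of_forall fun x => ?_)
          · rw [integrable_indicator_iff (measurableSet_padic_ball _)]
            exact integrableOn_const (measure_padic_ball_lt_top μ _).ne
          · have h := abs_JLm_sub_JL_le μ L v xs hm hxm x
            refine (Real.rpow_le_rpow (abs_nonneg _) h hρ0.le).trans (le_of_eq ?_)
            by_cases hx : ‖x‖ ≤ ‖m‖ <;> simp [Set.indicator, hx, hK, Real.zero_rpow hρ0.ne']
      _ = μ.real {x : ℚ_[p] | ‖x‖ ≤ ‖m‖} * (K * ‖m‖⁻¹) ^ ρ := by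
          rw [integral_indicator_const _ (measurableSet_padic_ball _), smul_eq_mul]
      _ ≤ ‖m‖ * (K * ‖m‖⁻¹) ^ ρ := by
          gcongr
          exact ENNReal.toReal_le_of_le_ofReal hm0.le (measure_padic_ball_le μ hμ m hm)
      _ = K ^ ρ * ‖m‖ ^ (-(ρ - 1)) := by
          rw [Real.mul_rpow hK0 (by positivity), Real.inv_rpow hm0.le, neg_sub,
            Real.rpow_sub hm0, Real.rpow_one]
          ring
  have hlt := hle.trans_lt (hT ‖m‖ hTm)
  rw [one_div]
  exact (Real.rpow_inv_lt_iff_of_pos (integral_nonneg fun x => by positivity) hε.le hρ0).2 hlt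
end

section
/- For every test function θ : ℚ_p → ℝ with ∫_{ℚ_p} θ dμ = 0, one has ∫_{ℚ_p} J_{L,m} θ dμ → ∫_{ℚ_p} J_L θ dμ as |m|_p → ∞: for every ε > 0 there exists M > 0 such that for every m ∈ ℚ_p with |m|_p ≥ M, |∫_{ℚ_p} J_{L,m} θ dμ − ∫_{ℚ_p} J_L θ dμ| < ε. (That is, J_{L,m} → J_L in the weak topology of Lizorkin distributions.) -/
open MeasureTheory

theorem IsTestFunction.continuous_s5 {p : ℕ} [Fact p.Prime] {φ : ℚ_[p] → ℝ}
    (hφ : IsTestFunction φ) : Continuous φ := by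
  have hp : (0 : ℝ) < p := by exact_mod_cast (Fact.out : p.Prime).pos
  rw [Metric.continuous_iff]
  intro x ε hε
  obtain ⟨l, hl⟩ := hφ.1 x
  refine ⟨(p : ℝ) ^ (-l), zpow_pos hp _, fun y hy => ?_⟩
  have h := hl (y - x) (by rw [← dist_eq_norm]; exact hy.le)
  rw [add_sub_cancel] at h
  rwa [h, dist_self]

theorem continuous_deltaL (p : ℕ) [Fact p.Prime] (L : ℕ) : Continuous (deltaL p L) := by
  have hp : (0 : ℝ) < p := by exact_mod_cast (Fact.out : p.Prime).pos
  have hclopen : IsClopen (Metric.closedBall (0 : ℚ_[p]) ((p : ℝ) ^ (-(L : ℤ)))) :=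
    IsUltrametricDist.isClopen_closedBall 0 (zpow_pos hp _).ne'
  have h : deltaL p L = (Metric.closedBall (0 : ℚ_[p]) ((p : ℝ) ^ (-(L : ℤ)))).indicator
      fun _ => (p : ℝ) ^ L := by
    classical
    funext x
    simp [deltaL, Set.indicator_apply]
  rw [h]
  exact continuous_const.indicator fun _ hx => by rw [hclopen.frontier_eq] at hx; exact hx.elim

theorem continuous_JL (p : ℕ) [Fact p.Prime] (L : ℕ) {N : ℕ} (v : Fin N → ℝ)
    (xs : Fin N → ℚ_[p]) : Continuous (JL p L v xs) :=
  continuous_finsetSum _ fun _ _ =>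
    continuous_const.mul ((continuous_deltaL p L).comp (continuous_id.sub continuous_const))

/-- The summand of the convolution defining `JLm` does not see the position of `x` once the ball of
radius `‖m‖` contains `x`, `a` and the unit ball. -/
theorem OmegaM_mul_deltaL (p : ℕ) [Fact p.Prime] (L : ℕ) {m x a : ℚ_[p]} (y : ℚ_[p])
    (h1 : 1 ≤ ‖m‖) (hx : ‖x‖ ≤ ‖m‖) (ha : ‖a‖ ≤ ‖m‖) :
    OmegaM p m (x - y) * deltaL p L (y - a) = ‖m‖⁻¹ * deltaL p L (y - a) := by
  by_cases hy : ‖y - a‖ ≤ (p : ℝ) ^ (-(L : ℤ))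
  · have hp : (1 : ℝ) ≤ p := by exact_mod_cast (Fact.out : p.Prime).one_le
    have hay : dist a y ≤ ‖m‖ := by
      rw [dist_comm, dist_eq_norm]
      exact hy.trans ((zpow_le_one_of_nonpos₀ hp (by simp)).trans h1)
    have hxa : dist x a ≤ ‖m‖ :=
      (dist_triangle_max x 0 a).trans (max_le (by simpa using hx) (by simpa using ha))
    have hxy : ‖x - y‖ ≤ ‖m‖ := by
      rw [← dist_eq_norm]
      exact (dist_triangle_max x a y).trans (max_le hxa hay)
    rw [OmegaM, if_pos hxy]
  · simp only [deltaL, if_neg hy, mul_zero]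

theorem JLm_eq_JL_sub_const (p : ℕ) [Fact p.Prime] [MeasurableSpace ℚ_[p]] (μ : Measure ℚ_[p])
    (L : ℕ) {N : ℕ} (v : Fin N → ℝ) (xs : Fin N → ℚ_[p]) {m x : ℚ_[p]}
    (h1 : 1 ≤ ‖m‖) (hx : ‖x‖ ≤ ‖m‖) (hxs : ∀ j, ‖xs j‖ ≤ ‖m‖) :
    JLm p μ L v xs m x =
      JL p L v xs x - ∑ j, v j * ∫ y, ‖m‖⁻¹ * deltaL p L (y - xs j) ∂μ := by
  simp only [JLm, OmegaM_mul_deltaL p L _ h1 hx (hxs _)]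

theorem stmt5 {p : ℕ} [Fact p.Prime] [MeasurableSpace ℚ_[p]] [BorelSpace ℚ_[p]]
    (μ : Measure ℚ_[p]) [μ.IsAddHaarMeasure]
    (hμ : μ {x : ℚ_[p] | ‖x‖ ≤ 1} = 1)
    (L : ℕ) (hL : 0 < L) {N : ℕ} (v : Fin N → ℝ) (xs : Fin N → ℚ_[p])
    (hxs : Function.Injective xs)
    (θ : ℚ_[p] → ℝ) (hθ : IsTestFunction θ) (hθ0 : ∫ x, θ x ∂μ = 0) :
    ∀ ε > (0 : ℝ), ∃ M > (0 : ℝ), ∀ m : ℚ_[p], M ≤ ‖m‖ →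
      |(∫ x, JLm p μ L v xs m x * θ x ∂μ) - ∫ x, JL p L v xs x * θ x ∂μ| < ε := by
  have hθi : Integrable θ μ := hθ.continuous_s5.integrable_of_hasCompactSupport hθ.2
  have hJθ : Integrable (fun x => JL p L v xs x * θ x) μ :=
    ((continuous_JL p L v xs).mul hθ.continuous_s5).integrable_of_hasCompactSupport hθ.2.mul_left
  obtain ⟨R, hR⟩ := (Metric.isBounded_iff_subset_closedBall 0).1 hθ.2.isCompact.isBounded
  have hS : 0 ≤ ∑ j, ‖xs j‖ := Finset.sum_nonneg fun j _ => norm_nonneg _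
  intro ε hε
  refine ⟨1 + |R| + ∑ j, ‖xs j‖, by positivity, fun m hm => ?_⟩
  have hxm (j : Fin N) : ‖xs j‖ ≤ ‖m‖ := by
    have := Finset.single_le_sum (fun i _ => norm_nonneg (xs i)) (Finset.mem_univ j)
    linarith [abs_nonneg R]
  have h1 : 1 ≤ ‖m‖ := by linarith [abs_nonneg R]
  set C := ∑ j, v j * ∫ y, ‖m‖⁻¹ * deltaL p L (y - xs j) ∂μ with hC
  have key : ∀ x, JLm p μ L v xs m x * θ x = JL p L v xs x * θ x - C * θ x := by
    intro x
    by_cases hx : θ x = 0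
    · simp [hx]
    · have hxR : ‖x‖ ≤ R := by simpa using hR (subset_tsupport θ hx)
      rw [JLm_eq_JL_sub_const p μ L v xs h1 (by linarith [le_abs_self R]) hxm, sub_mul]
  simp_rw [key]
  rw [integral_sub hJθ (hθi.const_mul C), integral_const_mul, hθ0]
  simpa using hε
end

section
/- Let θ : ℚ_p → ℝ be a test function with ∫_{ℚ_p} θ dμ = 0, and set ψ = f₁ ⋆ θ. Then for every x ∈ ℚ_p the integral defining (Dψ)(x) converges absolutely and (Dψ)(x) = θ(x); that is, ψ = f₁ ⋆ θ solves the Vladimirov equation Dψ = θ. -/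
open MeasureTheory

/-- `(f₁ ⋆ g)(x) = −((p−1)/(p ln p)) ∫ ln|x − y|_p g(y) dμ(y)`. -/
noncomputable def f1conv (p : ℕ) [Fact p.Prime] [MeasurableSpace ℚ_[p]]
    (μ : Measure ℚ_[p]) (g : ℚ_[p] → ℝ) (x : ℚ_[p]) : ℝ :=
  -(((p : ℝ) - 1) / ((p : ℝ) * Real.log p)) * ∫ y, Real.log ‖x - y‖ * g y ∂μ

open Metric

section Padic

variable {p : ℕ} [hp : Fact p.Prime]

lemma one_lt_cast_prime : (1 : ℝ) < p := mod_cast hp.1.one_lt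

lemma mem_closedBall_padic_iff_exists (k : ℤ) (x : ℚ_[p]) :
    ‖x‖ ≤ (p : ℝ) ^ (k + 1) ↔
      ∃ i ∈ Finset.range p, x ∈ closedBall ((i : ℚ_[p]) * (p : ℚ_[p]) ^ (-(k + 1))) ((p : ℝ) ^ k) := by
  have hp0 : (0 : ℝ) < p := mod_cast hp.1.pos
  have hpQ : (p : ℚ_[p]) ≠ 0 := mod_cast hp.1.ne_zero
  constructor
  · intro hx
    have hx1 : ‖x * (p : ℚ_[p]) ^ (k + 1)‖ ≤ 1 := by
      rw [norm_mul, Padic.norm_p_zpow, zpow_neg, ← div_eq_mul_inv]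
      exact div_le_one_of_le₀ hx (by positivity)
    obtain ⟨z, hz⟩ : ∃ z : ℤ_[p], (z : ℚ_[p]) = x * (p : ℚ_[p]) ^ (k + 1) := ⟨⟨_, hx1⟩, rfl⟩
    obtain ⟨i, hi, hmem⟩ := PadicInt.exists_mem_range z
    refine ⟨i, Finset.mem_range.2 hi, ?_⟩
    have h2 : ‖x * (p : ℚ_[p]) ^ (k + 1) - i‖ < 1 := by
      have := PadicInt.mem_nonunits.1 hmem
      rwa [PadicInt.norm_def, PadicInt.coe_sub, PadicInt.coe_natCast, hz] at this
    rw [mem_closedBall, dist_eq_norm, Padic.norm_le_pow_iff_norm_lt_pow_add_one]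
    have h3 : x - i * (p : ℚ_[p]) ^ (-(k + 1))
        = (x * (p : ℚ_[p]) ^ (k + 1) - i) * (p : ℚ_[p]) ^ (-(k + 1)) := by
      rw [sub_mul, mul_assoc, ← zpow_add₀ hpQ, add_neg_cancel, zpow_zero, mul_one]
    rw [h3, norm_mul, Padic.norm_p_zpow, neg_neg]
    exact mul_lt_of_lt_one_left (by positivity) h2
  · rintro ⟨i, -, hx⟩
    rw [mem_closedBall, dist_eq_norm] at hx
    have h1 : ‖(i : ℚ_[p]) * (p : ℚ_[p]) ^ (-(k + 1))‖ ≤ (p : ℝ) ^ (k + 1) := by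
      rw [norm_mul, Padic.norm_p_zpow, neg_neg]
      exact mul_le_of_le_one_left (by positivity) (Padic.norm_int_le_one i)
    have h2 : ‖x - (i : ℚ_[p]) * (p : ℚ_[p]) ^ (-(k + 1))‖ ≤ (p : ℝ) ^ (k + 1) :=
      hx.trans (zpow_le_zpow_right₀ one_lt_cast_prime.le (by lia))
    simpa using (IsUltrametricDist.norm_add_le_max _ _).trans (max_le h2 h1)

lemma disjoint_closedBall_padic (k : ℤ) {i j : ℕ} (hi : i < p) (hj : j < p) (hij : i ≠ j) :
    Disjoint (closedBall ((i : ℚ_[p]) * (p : ℚ_[p]) ^ (-(k + 1))) ((p : ℝ) ^ k))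
      (closedBall ((j : ℚ_[p]) * (p : ℚ_[p]) ^ (-(k + 1))) ((p : ℝ) ^ k)) := by
  have hp0 : (0 : ℝ) < p := mod_cast hp.1.pos
  rcases IsUltrametricDist.closedBall_eq_or_disjoint
    ((i : ℚ_[p]) * (p : ℚ_[p]) ^ (-(k + 1))) ((j : ℚ_[p]) * (p : ℚ_[p]) ^ (-(k + 1)))
    ((p : ℝ) ^ k) with h | h
  · exfalso
    have hm : (i : ℚ_[p]) * (p : ℚ_[p]) ^ (-(k + 1)) ∈
        closedBall ((j : ℚ_[p]) * (p : ℚ_[p]) ^ (-(k + 1))) ((p : ℝ) ^ k) := by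
      rw [← h]; exact mem_closedBall_self (by positivity)
    rw [mem_closedBall, dist_eq_norm, ← sub_mul, norm_mul, Padic.norm_p_zpow, neg_neg,
      zpow_add₀ hp0.ne', zpow_one] at hm
    have h1 : ‖(i : ℚ_[p]) - j‖ = 1 := by
      have hnd : ¬ (p : ℤ) ∣ (i : ℤ) - j := by
        intro hd
        apply hij
        have h5 : (i : ℤ) ≡ j [ZMOD p] := (Int.modEq_iff_dvd.2 (by simpa using hd)).symm
        rw [Int.natCast_modEq_iff] at h5
        exact Nat.ModEq.eq_of_lt_of_lt h5 hi hj
      have h6 : ¬ ‖(((i : ℤ) - j : ℤ) : ℚ_[p])‖ < 1 := by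
        rwa [Padic.norm_intCast_lt_one_iff]
      have h7 := Padic.norm_int_le_one (p := p) ((i : ℤ) - j)
      have h8 := le_antisymm h7 (not_lt.1 h6)
      simpa using h8
    rw [h1, one_mul] at hm
    have := one_lt_cast_prime (p := p)
    nlinarith [zpow_pos hp0 k]
  · exact h

variable [MeasurableSpace ℚ_[p]] [BorelSpace ℚ_[p]] (μ : Measure ℚ_[p]) [μ.IsAddHaarMeasure]

lemma measure_closedBall_padic_center (a : ℚ_[p]) (r : ℝ) :
    μ (closedBall a r) = μ (closedBall 0 r) := by
  have h : closedBall (0 : ℚ_[p]) r = (a + ·) ⁻¹' closedBall a r := by simp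
  rw [h, measure_preimage_add]

lemma measureReal_closedBall_padic_succ (k : ℤ) :
    μ.real (closedBall (0 : ℚ_[p]) ((p : ℝ) ^ (k + 1))) =
      p * μ.real (closedBall (0 : ℚ_[p]) ((p : ℝ) ^ k)) := by
  have h : closedBall (0 : ℚ_[p]) ((p : ℝ) ^ (k + 1)) = ⋃ i ∈ Finset.range p,
      closedBall ((i : ℚ_[p]) * (p : ℚ_[p]) ^ (-(k + 1))) ((p : ℝ) ^ k) := by
    ext x
    simpa using mem_closedBall_padic_iff_exists k x
  rw [h, measureReal_biUnion_finset (h := fun i _ => (isCompact_closedBall _ _).measure_lt_top.ne)]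
  · simp [measureReal_def, measure_closedBall_padic_center]
  · intro i hi j hj hij
    exact disjoint_closedBall_padic k (by simpa using hi) (by simpa using hj) hij
  · exact fun i _ => measurableSet_closedBall

variable {μ}

lemma measureReal_closedBall_padic (hμ : μ {x : ℚ_[p] | ‖x‖ ≤ 1} = 1) (k : ℤ) :
    μ.real (closedBall (0 : ℚ_[p]) ((p : ℝ) ^ k)) = (p : ℝ) ^ k := by
  have hp0 : (p : ℝ) ≠ 0 := mod_cast hp.1.ne_zero
  induction k using Int.induction_on with
  | zero =>
    have : closedBall (0 : ℚ_[p]) 1 = {x : ℚ_[p] | ‖x‖ ≤ 1} := by ext; simp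
    simp [measureReal_def, this, hμ]
  | succ k ih => rw [measureReal_closedBall_padic_succ, ih, zpow_add₀ hp0, zpow_one, mul_comm]
  | pred k ih =>
    have h := measureReal_closedBall_padic_succ μ (-(k : ℤ) - 1)
    rw [sub_add_cancel, ih] at h
    apply mul_left_cancel₀ hp0
    rw [← h, mul_comm, ← zpow_add_one₀ hp0, sub_add_cancel]

lemma measureReal_sphere_padic (hμ : μ {x : ℚ_[p] | ‖x‖ ≤ 1} = 1) (k : ℤ) :
    μ.real (sphere (0 : ℚ_[p]) ((p : ℝ) ^ k)) = (1 - (p : ℝ)⁻¹) * (p : ℝ) ^ k := by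
  have hp0 : (p : ℝ) ≠ 0 := mod_cast hp.1.ne_zero
  have h : sphere (0 : ℚ_[p]) ((p : ℝ) ^ k) =
      closedBall 0 ((p : ℝ) ^ k) \ closedBall 0 ((p : ℝ) ^ (k - 1)) := by
    ext x
    simp only [mem_sphere_iff_norm, sub_zero, Set.mem_sdiff, mem_closedBall_zero_iff,
      ← Padic.norm_lt_pow_iff_norm_le_pow_sub_one]
    rw [not_lt, le_antisymm_iff]
  rw [h, measureReal_sdiff (closedBall_subset_closedBall
      (zpow_le_zpow_right₀ one_lt_cast_prime.le (by lia))) measurableSet_closedBall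
      (isCompact_closedBall _ _).measure_lt_top.ne, measureReal_closedBall_padic hμ,
    measureReal_closedBall_padic hμ, zpow_sub₀ hp0, zpow_one]
  ring

lemma integral_radial_padic (hμ : μ {x : ℚ_[p] | ‖x‖ ≤ 1} = 1) {e : ℕ → ℤ}
    (he : Function.Injective e) {F : ℝ → ℝ} {S : ℝ}
    (hF : HasSum (fun k => F ((p : ℝ) ^ e k) * (p : ℝ) ^ e k) S) :
    IntegrableOn (fun y : ℚ_[p] => F ‖y‖) (⋃ k, sphere 0 ((p : ℝ) ^ e k)) μ ∧
      ∫ y in ⋃ k, sphere 0 ((p : ℝ) ^ e k), F ‖y‖ ∂μ = (1 - (p : ℝ)⁻¹) * S := by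
  have hp0 : (0 : ℝ) < p := mod_cast hp.1.pos
  have hms (k) : MeasurableSet (sphere (0 : ℚ_[p]) ((p : ℝ) ^ e k)) := isClosed_sphere.measurableSet
  have hEq (G : ℝ → ℝ) (k) : Set.EqOn (fun y : ℚ_[p] => G ‖y‖) (fun _ => G ((p : ℝ) ^ e k))
      (sphere (0 : ℚ_[p]) ((p : ℝ) ^ e k)) := by
    intro y hy
    rw [mem_sphere_zero_iff_norm] at hy
    simp [hy]
  have hint (G : ℝ → ℝ) (k) : ∫ y in sphere (0 : ℚ_[p]) ((p : ℝ) ^ e k), G ‖y‖ ∂μ =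
      (1 - (p : ℝ)⁻¹) * (G ((p : ℝ) ^ e k) * (p : ℝ) ^ e k) := by
    rw [setIntegral_congr_fun (hms k) (hEq G k), setIntegral_const, measureReal_sphere_padic hμ,
      smul_eq_mul]
    ring
  have hi : IntegrableOn (fun y : ℚ_[p] => F ‖y‖) (⋃ k, sphere 0 ((p : ℝ) ^ e k)) μ := by
    apply integrableOn_iUnion_of_summable_integral_norm
    · intro k
      rw [integrableOn_congr_fun (hEq F k) (hms k)]
      exact integrableOn_const (isCompact_sphere _ _).measure_lt_top.ne
    · simp only [hint (fun t => ‖F t‖)]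
      refine (hF.summable.abs.mul_left (1 - (p : ℝ)⁻¹)).congr fun k => ?_
      rw [abs_mul, abs_of_pos (zpow_pos hp0 (e k)), Real.norm_eq_abs]
  refine ⟨hi, ?_⟩
  refine (hasSum_integral_iUnion hms ?_ hi).unique ?_
  · intro i j hij
    refine Set.disjoint_left.2 fun y hy hy' => hij (he ?_)
    rw [mem_sphere_zero_iff_norm] at hy hy'
    exact zpow_right_injective₀ hp0 one_lt_cast_prime.ne' (hy.symm.trans hy')
  · simp only [hint F]
    exact hF.mul_left _

lemma hasSum_affine_mul_geometric {q : ℝ} (hq : 1 < q) (a b : ℝ) :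
    HasSum (fun k : ℕ => (a + b * k) * q⁻¹ ^ k)
      (a * (1 - q⁻¹)⁻¹ + b * (q⁻¹ / (1 - q⁻¹) ^ 2)) := by
  have h0 : 0 ≤ q⁻¹ := by positivity
  have h1 : q⁻¹ < 1 := inv_lt_one_of_one_lt₀ hq
  have := ((hasSum_geometric_of_lt_one h0 h1).mul_left a).add
    ((hasSum_coe_mul_geometric_of_norm_lt_one (r := q⁻¹)
      (by rwa [Real.norm_of_nonneg h0])).mul_left b)
  convert! this using 2
  ring

lemma integral_log_closedBall_padic (hμ : μ {x : ℚ_[p] | ‖x‖ ≤ 1} = 1) (n : ℤ) :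
    IntegrableOn (fun y : ℚ_[p] => Real.log ‖y‖) (closedBall 0 ((p : ℝ) ^ n)) μ ∧
      ∫ y in closedBall (0 : ℚ_[p]) ((p : ℝ) ^ n), Real.log ‖y‖ ∂μ =
        (p : ℝ) ^ n * (Real.log p * (n - 1 / ((p : ℝ) - 1))) := by
  have hp1 := one_lt_cast_prime (p := p)
  have hp0 : (0 : ℝ) < p := by linarith
  have hsum : HasSum (fun k : ℕ => Real.log ((p : ℝ) ^ (n - k : ℤ)) * (p : ℝ) ^ (n - k : ℤ))
      ((p : ℝ) ^ n * (n * Real.log p * (1 - (p : ℝ)⁻¹)⁻¹ +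
        -Real.log p * ((p : ℝ)⁻¹ / (1 - (p : ℝ)⁻¹) ^ 2))) := by
    convert! (hasSum_affine_mul_geometric hp1 (n * Real.log p) (-Real.log p)).mul_left
      ((p : ℝ) ^ n) using 2 with k
    rw [Real.log_zpow, zpow_sub₀ hp0.ne', zpow_natCast, inv_pow, div_eq_mul_inv]
    push_cast
    ring
  have h := integral_radial_padic hμ (e := fun k : ℕ => n - k)
    (fun i j hij => by simpa using hij) hsum
  have hset : closedBall (0 : ℚ_[p]) ((p : ℝ) ^ n) =ᵐ[μ]
      ⋃ k : ℕ, sphere 0 ((p : ℝ) ^ (n - k : ℤ)) := by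
    have h0 : ∀ᵐ y ∂μ, y ≠ (0 : ℚ_[p]) := by simp [ae_iff]
    filter_upwards [h0] with y hy
    refine propext ?_
    change y ∈ closedBall (0 : ℚ_[p]) ((p : ℝ) ^ n) ↔ y ∈ ⋃ k : ℕ, sphere 0 ((p : ℝ) ^ (n - k : ℤ))
    simp only [Set.mem_iUnion, mem_sphere_zero_iff_norm, mem_closedBall_zero_iff]
    rw [Padic.norm_eq_zpow_neg_valuation hy, zpow_le_zpow_iff_right₀ hp1]
    constructor
    · intro hle
      refine ⟨(n + y.valuation).toNat, ?_⟩
      congr 1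
      lia
    · rintro ⟨k, hk⟩
      have := zpow_right_injective₀ hp0 hp1.ne' hk
      lia
  refine ⟨h.1.congr_set_ae hset, ?_⟩
  rw [setIntegral_congr_set hset, h.2]
  have : (p : ℝ) - 1 ≠ 0 := by linarith
  have h2 : 1 - (p : ℝ)⁻¹ = (p - 1) / p := by field_simp
  rw [h2]
  field_simp
  ring

lemma integral_sub_log_div_compl_closedBall_padic (hμ : μ {x : ℚ_[p] | ‖x‖ ≤ 1} = 1) (n : ℤ)
    (c : ℝ) :
    IntegrableOn (fun y : ℚ_[p] => (c - Real.log ‖y‖) / ‖y‖ ^ 2) (closedBall 0 ((p : ℝ) ^ n))ᶜ μ ∧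
      ∫ y in (closedBall (0 : ℚ_[p]) ((p : ℝ) ^ n))ᶜ, (c - Real.log ‖y‖) / ‖y‖ ^ 2 ∂μ =
        ((p : ℝ) ^ n)⁻¹ * ((p : ℝ)⁻¹ *
          (c - (n + 1) * Real.log p - Real.log p / ((p : ℝ) - 1))) := by
  have hp1 := one_lt_cast_prime (p := p)
  have hp0 : (0 : ℝ) < p := by linarith
  have hsum : HasSum (fun k : ℕ => (c - Real.log ((p : ℝ) ^ (n + 1 + k : ℤ))) /
        ((p : ℝ) ^ (n + 1 + k : ℤ)) ^ 2 * (p : ℝ) ^ (n + 1 + k : ℤ))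
      (((p : ℝ) ^ n)⁻¹ * (p : ℝ)⁻¹ * ((c - (n + 1) * Real.log p) * (1 - (p : ℝ)⁻¹)⁻¹ +
        -Real.log p * ((p : ℝ)⁻¹ / (1 - (p : ℝ)⁻¹) ^ 2))) := by
    convert! (hasSum_affine_mul_geometric hp1 (c - (n + 1) * Real.log p) (-Real.log p)).mul_left
      (((p : ℝ) ^ n)⁻¹ * (p : ℝ)⁻¹) using 2 with k
    rw [Real.log_zpow, zpow_add₀ hp0.ne', zpow_add₀ hp0.ne', zpow_natCast, zpow_one,
      inv_pow]
    push_cast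
    field_simp
    ring
  have h := integral_radial_padic hμ (e := fun k : ℕ => n + 1 + k)
    (F := fun t => (c - Real.log t) / t ^ 2) (fun i j hij => by simpa using hij) hsum
  have hset : (closedBall (0 : ℚ_[p]) ((p : ℝ) ^ n))ᶜ =
      ⋃ k : ℕ, sphere 0 ((p : ℝ) ^ (n + 1 + k : ℤ)) := by
    ext y
    simp only [Set.mem_iUnion, mem_sphere_zero_iff_norm, Set.mem_compl_iff,
      mem_closedBall_zero_iff]
    rcases eq_or_ne y 0 with rfl | hy
    · simp only [norm_zero]
      constructor
      · intro h; exact absurd (zpow_pos hp0 n).le h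
      · rintro ⟨k, hk⟩; exact absurd hk (zpow_pos hp0 _).ne
    rw [Padic.norm_eq_zpow_neg_valuation hy, zpow_le_zpow_iff_right₀ hp1]
    constructor
    · intro hle
      refine ⟨(-y.valuation - n - 1).toNat, ?_⟩
      congr 1
      lia
    · rintro ⟨k, hk⟩
      have := zpow_right_injective₀ hp0 hp1.ne' hk
      lia
  rw [hset]
  refine ⟨h.1, ?_⟩
  rw [h.2]
  have : (p : ℝ) - 1 ≠ 0 := by linarith
  have h2 : 1 - (p : ℝ)⁻¹ = (p - 1) / p := by field_simp
  rw [h2]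
  field_simp
  ring

variable (p) in
/-- The logarithmic potential `∫ log ‖x - y‖ dy` over the ball `‖y‖ ≤ p ^ n`. -/
noncomputable def ballPotential (n : ℤ) (x : ℚ_[p]) : ℝ :=
  if ‖x‖ ≤ (p : ℝ) ^ n then (p : ℝ) ^ n * (Real.log p * (n - 1 / ((p : ℝ) - 1)))
  else (p : ℝ) ^ n * Real.log ‖x‖

lemma integral_log_sub_mul_indicator_closedBall (hμ : μ {x : ℚ_[p] | ‖x‖ ≤ 1} = 1) (n : ℤ)
    (a x : ℚ_[p]) :
    Integrable (fun y => Real.log ‖x - y‖ *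
        (closedBall a ((p : ℝ) ^ n)).indicator (fun _ => (1 : ℝ)) y) μ ∧
      ∫ y, Real.log ‖x - y‖ * (closedBall a ((p : ℝ) ^ n)).indicator (fun _ => (1 : ℝ)) y ∂μ =
        ballPotential p n (x - a) := by
  by_cases hx : ‖x - a‖ ≤ (p : ℝ) ^ n
  · have hball : closedBall a ((p : ℝ) ^ n) = closedBall x ((p : ℝ) ^ n) :=
      IsUltrametricDist.closedBall_eq_of_mem (by rwa [mem_closedBall, dist_eq_norm])
    have hfun : (fun y => Real.log ‖x - y‖ *
        (closedBall a ((p : ℝ) ^ n)).indicator (fun _ => (1 : ℝ)) y) =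
        fun y => (closedBall (0 : ℚ_[p]) ((p : ℝ) ^ n)).indicator (fun y => Real.log ‖y‖) (x - y) := by
      ext y
      have hmem : y ∈ closedBall x ((p : ℝ) ^ n) ↔ x - y ∈ closedBall (0 : ℚ_[p]) ((p : ℝ) ^ n) := by
        rw [mem_closedBall', dist_eq_norm, mem_closedBall_zero_iff]
      rw [hball]
      by_cases hy : y ∈ closedBall x ((p : ℝ) ^ n)
      · rw [Set.indicator_of_mem hy, Set.indicator_of_mem (hmem.1 hy), mul_one]
      · rw [Set.indicator_of_notMem hy, Set.indicator_of_notMem (mt hmem.2 hy), mul_zero]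
    have hlog := integral_log_closedBall_padic hμ n
    rw [hfun]
    refine ⟨(hlog.1.integrable_indicator measurableSet_closedBall).comp_sub_left x, ?_⟩
    rw [integral_sub_left_eq_self (fun y => (closedBall (0 : ℚ_[p]) ((p : ℝ) ^ n)).indicator
      (fun y => Real.log ‖y‖) y), integral_indicator measurableSet_closedBall, hlog.2,
      ballPotential, if_pos hx]
  · have hfun : (fun y => Real.log ‖x - y‖ *
        (closedBall a ((p : ℝ) ^ n)).indicator (fun _ => (1 : ℝ)) y) =
        (closedBall a ((p : ℝ) ^ n)).indicator (fun _ => Real.log ‖x - a‖) := by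
      ext y
      by_cases hy : y ∈ closedBall a ((p : ℝ) ^ n)
      · rw [Set.indicator_of_mem hy, Set.indicator_of_mem hy, mul_one]
        rw [mem_closedBall, dist_eq_norm, norm_sub_rev] at hy
        have hne : ‖a - y‖ < ‖x - a‖ := hy.trans_lt (not_le.1 hx)
        rw [← sub_add_sub_cancel x a y, IsUltrametricDist.norm_add_eq_max_of_norm_ne_norm hne.ne',
          max_eq_left hne.le]
      · simp [Set.indicator_of_notMem hy]
    rw [hfun]
    refine ⟨(integrableOn_const (isCompact_closedBall _ _).measure_lt_top.ne).integrable_indicator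
      measurableSet_closedBall, ?_⟩
    rw [integral_indicator_const _ measurableSet_closedBall, measureReal_def,
      measure_closedBall_padic_center, ← measureReal_def,
      measureReal_closedBall_padic hμ, ballPotential, if_neg hx, smul_eq_mul]

lemma integral_log_sub_log_div (hμ : μ {x : ℚ_[p] | ‖x‖ ≤ 1} = 1) {x : ℚ_[p]} (hx : x ≠ 0) :
    Integrable (fun y => (Real.log ‖x‖ - Real.log ‖y‖) / ‖x - y‖ ^ 2) μ ∧
      ∫ y, (Real.log ‖x‖ - Real.log ‖y‖) / ‖x - y‖ ^ 2 ∂μ = 0 := by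
  have hp1 := one_lt_cast_prime (p := p)
  have hp0 : (0 : ℝ) < p := by linarith
  obtain ⟨m, hm⟩ : ∃ m : ℤ, ‖x‖ = (p : ℝ) ^ m := ⟨_, Padic.norm_eq_zpow_neg_valuation hx⟩
  have hin := integral_log_closedBall_padic hμ (m - 1)
  have hout := integral_sub_log_div_compl_closedBall_padic hμ m (Real.log ‖x‖)
  have hfun : (fun y => (Real.log ‖x‖ - Real.log ‖y‖) / ‖x - y‖ ^ 2) =
      fun y => (closedBall (0 : ℚ_[p]) ((p : ℝ) ^ (m - 1))).indicator
          (fun y => (Real.log ‖x‖ - Real.log ‖y‖) / ‖x‖ ^ 2) y +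
        (closedBall (0 : ℚ_[p]) ((p : ℝ) ^ m))ᶜ.indicator
          (fun y => (Real.log ‖x‖ - Real.log ‖y‖) / ‖y‖ ^ 2) y := by
    ext y
    have h1 : y ∈ closedBall (0 : ℚ_[p]) ((p : ℝ) ^ (m - 1)) ↔ ‖y‖ < ‖x‖ := by
      rw [mem_closedBall_zero_iff, hm, Padic.norm_lt_pow_iff_norm_le_pow_sub_one]
    have h2 : y ∈ (closedBall (0 : ℚ_[p]) ((p : ℝ) ^ m))ᶜ ↔ ‖x‖ < ‖y‖ := by
      rw [Set.mem_compl_iff, mem_closedBall_zero_iff, hm, not_le]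
    rcases lt_trichotomy ‖y‖ ‖x‖ with h | h | h
    · have : ‖x - y‖ = ‖x‖ := by
        rw [sub_eq_add_neg, IsUltrametricDist.norm_add_eq_max_of_norm_ne_norm
          (by rw [norm_neg]; exact h.ne'), norm_neg, max_eq_left h.le]
      rw [Set.indicator_of_mem (h1.2 h), Set.indicator_of_notMem (mt h2.1 h.not_gt), this, add_zero]
    · rw [Set.indicator_of_notMem (mt h1.1 h.not_lt), Set.indicator_of_notMem (mt h2.1 h.not_gt),
        h, sub_self, zero_div, add_zero]
    · have : ‖x - y‖ = ‖y‖ := by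
        rw [sub_eq_add_neg, IsUltrametricDist.norm_add_eq_max_of_norm_ne_norm
          (by rw [norm_neg]; exact h.ne), norm_neg, max_eq_right h.le]
      rw [Set.indicator_of_notMem (mt h1.1 h.not_gt), Set.indicator_of_mem (h2.2 h), this, zero_add]
  have hc : IntegrableOn (fun _ : ℚ_[p] => Real.log ‖x‖) (closedBall 0 ((p : ℝ) ^ (m - 1))) μ :=
    integrableOn_const (isCompact_closedBall _ _).measure_lt_top.ne
  have hi1 := IntegrableOn.integrable_indicator ((hc.sub hin.1).div_const (‖x‖ ^ 2))
    measurableSet_closedBall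
  have hi2 := hout.1.integrable_indicator measurableSet_closedBall.compl
  rw [hfun]
  refine ⟨hi1.add hi2, ?_⟩
  refine (integral_add hi1 hi2).trans ?_
  rw [integral_indicator measurableSet_closedBall, integral_indicator measurableSet_closedBall.compl,
    hout.2]
  simp only [Pi.sub_apply]
  rw [integral_div, integral_sub hc hin.1, hin.2, setIntegral_const,
    measureReal_closedBall_padic hμ, hm, Real.log_zpow, zpow_sub_one₀ hp0.ne', smul_eq_mul]
  have : (p : ℝ) - 1 ≠ 0 := by linarith
  push_cast
  field_simp
  ring

lemma integral_ballPotential_sub_div (hμ : μ {x : ℚ_[p] | ‖x‖ ≤ 1} = 1) (n : ℤ) (x : ℚ_[p]) :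
    Integrable (fun y => (ballPotential p n x - ballPotential p n y) / ‖x - y‖ ^ 2) μ ∧
      ∫ y, (ballPotential p n x - ballPotential p n y) / ‖x - y‖ ^ 2 ∂μ =
        -(Real.log p * (p + 1) / (p * (p - 1))) *
          (closedBall (0 : ℚ_[p]) ((p : ℝ) ^ n)).indicator (fun _ => (1 : ℝ)) x := by
  have hp1 := one_lt_cast_prime (p := p)
  have hp0 : (0 : ℝ) < p := by linarith
  have hpm : (p : ℝ) - 1 ≠ 0 := by linarith
  by_cases hx : ‖x‖ ≤ (p : ℝ) ^ n
  · have hout := integral_sub_log_div_compl_closedBall_padic hμ n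
      (Real.log p * (n - 1 / ((p : ℝ) - 1)))
    have hfun : (fun y => (ballPotential p n x - ballPotential p n y) / ‖x - y‖ ^ 2) =
        fun y => (p : ℝ) ^ n * (closedBall (0 : ℚ_[p]) ((p : ℝ) ^ n))ᶜ.indicator
          (fun y => (Real.log p * (n - 1 / ((p : ℝ) - 1)) - Real.log ‖y‖) / ‖y‖ ^ 2) y := by
      ext y
      rw [ballPotential, ballPotential, if_pos hx]
      by_cases hy : ‖y‖ ≤ (p : ℝ) ^ n
      · simp [hy]
      · have hlt := hx.trans_lt (not_le.1 hy)
        have : ‖x - y‖ = ‖y‖ := by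
          rw [sub_eq_add_neg, IsUltrametricDist.norm_add_eq_max_of_norm_ne_norm
            (by rw [norm_neg]; exact hlt.ne), norm_neg, max_eq_right hlt.le]
        rw [if_neg hy, this, Set.indicator_of_mem (by simpa using hy)]
        ring
    rw [hfun]
    refine ⟨(hout.1.integrable_indicator measurableSet_closedBall.compl).const_mul _, ?_⟩
    rw [integral_const_mul, integral_indicator measurableSet_closedBall.compl, hout.2,
      Set.indicator_of_mem (by simpa using hx)]
    field_simp
    ring
  · have hx0 : x ≠ 0 := by
      rintro rfl
      exact hx (by simpa using (zpow_pos hp0 n).le)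
    have hin := integral_log_closedBall_padic hμ n
    have hlog := integral_log_sub_log_div hμ hx0
    have hc : IntegrableOn (fun _ : ℚ_[p] => Real.log p * (n - 1 / ((p : ℝ) - 1)))
        (closedBall 0 ((p : ℝ) ^ n)) μ :=
      integrableOn_const (isCompact_closedBall _ _).measure_lt_top.ne
    have hi := IntegrableOn.integrable_indicator ((hc.sub hin.1).const_mul
      ((p : ℝ) ^ n / ‖x‖ ^ 2)) measurableSet_closedBall
    have hfun : (fun y => (ballPotential p n x - ballPotential p n y) / ‖x - y‖ ^ 2) =
        fun y => (p : ℝ) ^ n * ((Real.log ‖x‖ - Real.log ‖y‖) / ‖x - y‖ ^ 2) -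
          (closedBall (0 : ℚ_[p]) ((p : ℝ) ^ n)).indicator (fun y => (p : ℝ) ^ n / ‖x‖ ^ 2 *
            (Real.log p * (n - 1 / ((p : ℝ) - 1)) - Real.log ‖y‖)) y := by
      ext y
      rw [ballPotential, ballPotential, if_neg hx]
      by_cases hy : ‖y‖ ≤ (p : ℝ) ^ n
      · have hlt := hy.trans_lt (not_le.1 hx)
        have : ‖x - y‖ = ‖x‖ := by
          rw [sub_eq_add_neg, IsUltrametricDist.norm_add_eq_max_of_norm_ne_norm
            (by rw [norm_neg]; exact hlt.ne'), norm_neg, max_eq_left hlt.le]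
        rw [if_pos hy, this, Set.indicator_of_mem (by simpa using hy)]
        ring
      · rw [if_neg hy, Set.indicator_of_notMem (by simpa using hy)]
        ring
    rw [hfun]
    refine ⟨(hlog.1.const_mul _).sub hi, ?_⟩
    refine (integral_sub (hlog.1.const_mul _) hi).trans ?_
    rw [integral_const_mul, hlog.2, integral_indicator measurableSet_closedBall]
    simp only [Pi.sub_apply]
    rw [integral_const_mul, integral_sub hc hin.1, hin.2, setIntegral_const,
      measureReal_closedBall_padic hμ, smul_eq_mul, sub_self,
      Set.indicator_of_notMem (by simpa using hx)]
    simp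

end Padic

lemma IsTestFunction.exists_eq_sum_indicator {p : ℕ} [hp : Fact p.Prime] {θ : ℚ_[p] → ℝ}
    (hθ : IsTestFunction θ) : ∃ (n : ℤ) (s : Finset ℚ_[p]), ∀ z, θ z =
      ∑ a ∈ s, θ a * (closedBall a ((p : ℝ) ^ n)).indicator (fun _ => (1 : ℝ)) z := by
  classical
  have hp1 := one_lt_cast_prime (p := p)
  have hp0 : (0 : ℝ) < p := by linarith
  obtain ⟨hloc, hK⟩ := hθ
  have hopen (v : ℝ) : IsOpen {z | θ z = v} := by
    rw [Metric.isOpen_iff]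
    intro z hz
    obtain ⟨l, hl⟩ := hloc z
    refine ⟨(p : ℝ) ^ (-l), zpow_pos hp0 _, fun w hw => ?_⟩
    rw [mem_ball, dist_eq_norm] at hw
    have := hl (w - z) hw.le
    rw [add_sub_cancel] at this
    exact this.trans hz
  obtain ⟨δ, hδ, hδK⟩ := lebesgue_number_lemma_of_metric hK hopen
    (fun z _ => Set.mem_iUnion.2 ⟨θ z, rfl⟩)
  obtain ⟨k, hk⟩ := exists_pow_lt_of_lt_one hδ (inv_lt_one_of_one_lt₀ hp1)
  set r : ℝ := (p : ℝ) ^ (-(k : ℤ)) with hr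
  have hr0 : 0 < r := zpow_pos hp0 _
  have hrδ : r < δ := by rwa [hr, zpow_neg, zpow_natCast, ← inv_pow]
  have hconst : ∀ x ∈ tsupport θ, ∀ z ∈ closedBall x r, θ z = θ x := by
    intro x hx z hz
    obtain ⟨v, hv⟩ := hδK x hx
    exact (hv (closedBall_subset_ball hrδ hz)).trans (hv (mem_ball_self hδ)).symm
  obtain ⟨t, htK, ht⟩ := hK.elim_nhds_subcover (fun a => closedBall a r)
    (fun a _ => closedBall_mem_nhds a hr0)
  obtain ⟨s, hst, hinj, himg⟩ := Finset.exists_subset_injOn_image_eq_of_surjOn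
    (f := fun a => closedBall a r) t (t.image fun a => closedBall a r)
    (by rw [Finset.coe_image]; exact Set.surjOn_image _ _)
  refine ⟨-k, s, fun z => ?_⟩
  change θ z = ∑ a ∈ s, θ a * (closedBall a r).indicator (fun _ => (1 : ℝ)) z
  by_cases hz : ∃ a ∈ s, z ∈ closedBall a r
  · obtain ⟨a, ha, hza⟩ := hz
    rw [Finset.sum_eq_single_of_mem a ha, Set.indicator_of_mem hza, mul_one]
    · exact hconst a (htK a (hst ha)) z hza
    · intro b hb hba
      rw [Set.indicator_of_notMem, mul_zero]
      intro hzb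
      exact hba (hinj hb ha ((IsUltrametricDist.closedBall_eq_of_mem hzb).trans
        (IsUltrametricDist.closedBall_eq_of_mem hza).symm))
  · push Not at hz
    rw [Finset.sum_eq_zero fun a ha => by rw [Set.indicator_of_notMem (hz a ha), mul_zero]]
    by_contra hne
    obtain ⟨a, hat, hza⟩ := Set.mem_iUnion₂.1 (ht (subset_tsupport _ hne))
    obtain ⟨b, hb, hba⟩ := Finset.mem_image.1 (himg ▸ Finset.mem_image_of_mem _ hat)
    exact hz b hb (hba ▸ hza)

theorem stmt6 {p : ℕ} [Fact p.Prime] [MeasurableSpace ℚ_[p]] [BorelSpace ℚ_[p]]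
    (μ : Measure ℚ_[p]) [μ.IsAddHaarMeasure]
    (hμ : μ {x : ℚ_[p] | ‖x‖ ≤ 1} = 1)
    (θ : ℚ_[p] → ℝ) (hθ : IsTestFunction θ) (hθ0 : ∫ x, θ x ∂μ = 0) :
    ∀ x : ℚ_[p],
      Integrable (fun y => (f1conv p μ θ x - f1conv p μ θ y) / ‖x - y‖ ^ 2) μ ∧
      ((p : ℝ) ^ 2 / ((p : ℝ) + 1)) *
          ∫ y, (f1conv p μ θ x - f1conv p μ θ y) / ‖x - y‖ ^ 2 ∂μ = θ x := by
  intro x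
  have hp1 := one_lt_cast_prime (p := p)
  obtain ⟨n, s, hs⟩ := hθ.exists_eq_sum_indicator
  set C : ℝ := -(((p : ℝ) - 1) / ((p : ℝ) * Real.log p)) with hC
  have hconv (z : ℚ_[p]) : f1conv p μ θ z = ∑ a ∈ s, C * θ a * ballPotential p n (z - a) := by
    have hlog (a : ℚ_[p]) := integral_log_sub_mul_indicator_closedBall hμ n a z
    have hfun : (fun y => Real.log ‖z - y‖ * θ y) = fun y => ∑ a ∈ s, θ a * (Real.log ‖z - y‖ *
        (closedBall a ((p : ℝ) ^ n)).indicator (fun _ => (1 : ℝ)) y) := by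
      ext y
      rw [hs y, Finset.mul_sum]
      exact Finset.sum_congr rfl fun a _ => by ring
    rw [f1conv, hfun, integral_finsetSum _ fun a _ => (hlog a).1.const_mul _, Finset.mul_sum]
    exact Finset.sum_congr rfl fun a _ => by rw [integral_const_mul, (hlog a).2, ← mul_assoc]
  have hpot (a : ℚ_[p]) := integral_ballPotential_sub_div hμ n (x - a)
  have hfun : (fun y => (f1conv p μ θ x - f1conv p μ θ y) / ‖x - y‖ ^ 2) =
      fun y => ∑ a ∈ s, C * θ a * ((ballPotential p n (x - a) - ballPotential p n (y - a)) /
        ‖(x - a) - (y - a)‖ ^ 2) := by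
    ext y
    rw [hconv, hconv, ← Finset.sum_sub_distrib, Finset.sum_div]
    refine Finset.sum_congr rfl fun a _ => ?_
    rw [sub_sub_sub_cancel_right]
    ring
  have hint (a : ℚ_[p]) := ((hpot a).1.comp_sub_right a).const_mul (C * θ a)
  rw [hfun]
  refine ⟨integrable_finsetSum _ fun a _ => hint a, ?_⟩
  rw [integral_finsetSum _ fun a _ => hint a, Finset.mul_sum, hs x]
  refine Finset.sum_congr rfl fun a _ => ?_
  rw [integral_const_mul, integral_sub_right_eq_self
    (fun y => (ballPotential p n (x - a) - ballPotential p n y) / ‖(x - a) - y‖ ^ 2), (hpot a).2]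
  have hind : (closedBall (0 : ℚ_[p]) ((p : ℝ) ^ n)).indicator (fun _ => (1 : ℝ)) (x - a) =
      (closedBall a ((p : ℝ) ^ n)).indicator (fun _ => (1 : ℝ)) x := by
    have hmem : x - a ∈ closedBall (0 : ℚ_[p]) ((p : ℝ) ^ n) ↔ x ∈ closedBall a ((p : ℝ) ^ n) := by
      rw [mem_closedBall_zero_iff, mem_closedBall, dist_eq_norm]
    by_cases hx : x ∈ closedBall a ((p : ℝ) ^ n)
    · rw [Set.indicator_of_mem hx, Set.indicator_of_mem (hmem.2 hx)]
    · rw [Set.indicator_of_notMem hx, Set.indicator_of_notMem (mt hmem.1 hx)]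
  have hlogp : Real.log p ≠ 0 := (Real.log_pos hp1).ne'
  have hpm : (p : ℝ) - 1 ≠ 0 := by linarith
  have hpp : (p : ℝ) + 1 ≠ 0 := by linarith
  rw [hind, hC]
  field_simp
end
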